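/- If one-sided topological Markov shifts (X_A, σ_A) and (X_B, σ_B) are continuously orbit equivalent, then they are one-sided flow equivalent. -/

import Mathlib

open scoped BigOperators NNReal

namespace OneSidedMarkov

variable {N M : ℕ}

/-- The matrix has entries in `{0, 1}`. -/
def IsZeroOne (A : Matrix (Fin N) (Fin N) ℤ) : Prop := ∀ i j, A i j = 0 ∨ A i j = 1

/-- The matrix is irreducible. -/
def IsIrreducible (A : Matrix (Fin N) (Fin N) ℤ) : Prop :=
  ∀ i j, ∃ m : ℕ, 0 < m ∧ (A ^ m) i j ≠ 0

/-- The matrix is a permutation matrix. -/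
def IsPermutationMatrix (A : Matrix (Fin N) (Fin N) ℤ) : Prop :=
  ∃ e : Equiv.Perm (Fin N), ∀ i j, A i j = if e i = j then 1 else 0

/-- The one-sided topological Markov shift space `X_A`. -/
abbrev Space (A : Matrix (Fin N) (Fin N) ℤ) : Type :=
  {x : ℕ → Fin N // ∀ n, A (x n) (x (n + 1)) = 1}

/-- The shift map `σ_A`. -/
def shift (A : Matrix (Fin N) (Fin N) ℤ) (x : Space A) : Space A :=
  ⟨fun n => x.1 (n + 1), fun n => x.2 (n + 1)⟩

lemma continuous_shift (A : Matrix (Fin N) (Fin N) ℤ) : Continuous (shift A) := by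
  apply Continuous.subtype_mk
  exact continuous_pi fun n => (continuous_apply (n + 1)).comp continuous_subtype_val

/-- The shift map as a continuous map. -/
def shiftMap (A : Matrix (Fin N) (Fin N) ℤ) : C(Space A, Space A) :=
  ⟨shift A, continuous_shift A⟩

/-- The coboundary subgroup `{ g - g ∘ σ_A }` of `C(X_A, ℤ)`. -/
def cobdySubgroup (A : Matrix (Fin N) (Fin N) ℤ) : AddSubgroup C(Space A, ℤ) :=
  AddSubgroup.closure {f | ∃ g : C(Space A, ℤ), f = g - g.comp (shiftMap A)}

/-- The ordered cohomology group `H^A = C(X_A, ℤ)/{g - g∘σ_A}`. -/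
abbrev Coh (A : Matrix (Fin N) (Fin N) ℤ) : Type :=
  C(Space A, ℤ) ⧸ cobdySubgroup A

/-- The class `[f] ∈ H^A`. -/
def cohClass (A : Matrix (Fin N) (Fin N) ℤ) (f : C(Space A, ℤ)) : Coh A :=
  QuotientAddGroup.mk f

/-- The positive cone `H^A_+`. -/
def CohPos (A : Matrix (Fin N) (Fin N) ℤ) : Set (Coh A) :=
  {c | ∃ f : C(Space A, ℤ), (∀ x, 0 ≤ f x) ∧ c = cohClass A f}

/-- `u` is an order unit of `(H^A, H^A_+)`. -/
def IsOrderUnit (A : Matrix (Fin N) (Fin N) ℤ) (u : Coh A) : Prop :=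
  u ∈ CohPos A ∧ ∀ g : Coh A, ∃ n : ℕ, 0 < n ∧ n • u - g ∈ CohPos A

/-- The data `(l, k, b)` of a suspension. -/
structure SuspData (A : Matrix (Fin N) (Fin N) ℤ) where
  l : C(Space A, ℝ)
  k : C(Space A, ℝ)
  b : C(Space A, ℝ)

/-- `c = l - k`. -/
def cFun {A : Matrix (Fin N) (Fin N) ℤ} (T : SuspData A) (x : Space A) : ℝ :=
  T.l x - T.k x

/-- `(l, k, b)` is a suspension triplet for `(X_A, σ_A)`. -/
def IsSuspTriplet {A : Matrix (Fin N) (Fin N) ℤ} (T : SuspData A) : Prop :=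
  (∀ x, 0 ≤ T.l x) ∧ (∀ x, 0 ≤ T.k x) ∧
  (∃ c : C(Space A, ℤ), (∀ x, (c x : ℝ) = cFun T x) ∧ IsOrderUnit A (cohClass A c)) ∧
  (∀ x, ∃ m : ℕ, T.l x - T.b x = m) ∧
  (∀ x, ∃ m : ℕ, T.k x - T.b (shift A x) = m)

/-- The space `X_{A,b}^ℝ = {(x, r) : r ≥ b(x)}`. -/
abbrev BaseSpace {A : Matrix (Fin N) (Fin N) ℤ} (T : SuspData A) : Type :=
  {p : Space A × ℝ // T.b p.1 ≤ p.2}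

/-- The elementary relation `(x, r) ∼ (σ_A(x), r - c(x))` for `r ≥ l(x)`. -/
def SuspRel {A : Matrix (Fin N) (Fin N) ℤ} (T : SuspData A)
    (p q : BaseSpace T) : Prop :=
  T.l p.1.1 ≤ p.1.2 ∧ q.1 = (shift A p.1.1, p.1.2 - cFun T p.1.1)

/-- The equivalence relation `∼_{l,k}` generated by `SuspRel`. -/
def suspSetoid {A : Matrix (Fin N) (Fin N) ℤ} (T : SuspData A) : Setoid (BaseSpace T) :=
  ⟨Relation.EqvGen (SuspRel T), Relation.EqvGen.is_equivalence _⟩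

/-- The one-sided suspension `S_{A,b}^{l,k}` with the quotient topology. -/
abbrev Susp {A : Matrix (Fin N) (Fin N) ℤ} (T : SuspData A) : Type :=
  Quotient (suspSetoid T)

/-- The class `[x, r]`. -/
def mkSusp {A : Matrix (Fin N) (Fin N) ℤ} (T : SuspData A) (p : BaseSpace T) : Susp T :=
  Quotient.mk (suspSetoid T) p

/-- The base map `x ↦ [x, b(x)]`. -/
def basePoint {A : Matrix (Fin N) (Fin N) ℤ} (T : SuspData A) (x : Space A) : Susp T :=
  mkSusp T ⟨(x, T.b x), le_refl _⟩

/-- Translation by `t ≥ 0` on `X_{A,b}^ℝ`. -/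
def shiftPt {A : Matrix (Fin N) (Fin N) ℤ} (T : SuspData A) (t : ℝ≥0)
    (p : BaseSpace T) : BaseSpace T :=
  ⟨(p.1.1, p.1.2 + t), le_trans p.2 (le_add_of_nonneg_right t.2)⟩

lemma suspRel_shiftPt {A : Matrix (Fin N) (Fin N) ℤ} (T : SuspData A) (t : ℝ≥0)
    {p q : BaseSpace T} (h : SuspRel T p q) : SuspRel T (shiftPt T t p) (shiftPt T t q) := by
  obtain ⟨h1, h2⟩ := h
  refine ⟨le_trans h1 (le_add_of_nonneg_right t.2), ?_⟩
  show (q.1.1, q.1.2 + (t : ℝ)) = _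
  rw [h2]
  show (shift A p.1.1, p.1.2 - cFun T p.1.1 + (t : ℝ))
      = (shift A p.1.1, p.1.2 + (t : ℝ) - cFun T p.1.1)
  congr 1
  ring

lemma eqvGen_map {α : Type*} {r r' : α → α → Prop} (f : α → α)
    (hf : ∀ a b, r a b → r' (f a) (f b)) :
    ∀ a b, Relation.EqvGen r a b → Relation.EqvGen r' (f a) (f b) := by
  intro a b h
  induction h with
  | rel a b hab => exact Relation.EqvGen.rel _ _ (hf a b hab)
  | refl a => exact Relation.EqvGen.refl _
  | symm a b _ ih => exact Relation.EqvGen.symm _ _ ih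
  | trans a b c _ _ ih1 ih2 => exact Relation.EqvGen.trans _ _ _ ih1 ih2

/-- The flow `φ_{A,t}([x, r]) = [x, r + t]`, `t ∈ ℝ_+`, on the one-sided suspension. -/
def flow {A : Matrix (Fin N) (Fin N) ℤ} (T : SuspData A) (t : ℝ≥0) :
    Susp T → Susp T :=
  Quotient.map' (shiftPt T t)
    (fun p q h => eqvGen_map (shiftPt T t) (fun _ _ hr => suspRel_shiftPt T t hr) p q h)

/-- The standard suspension data `(1, 0, 0)`. -/
def stdData (A : Matrix (Fin N) (Fin N) ℤ) : SuspData A := ⟨1, 0, 0⟩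

/-- The standard one-sided suspension `S_A^1`. -/
abbrev StdSusp (A : Matrix (Fin N) (Fin N) ℤ) : Type := Susp (stdData A)

/-- The standard base map `s_A(x) = [x, 0]`. -/
def stdBase (A : Matrix (Fin N) (Fin N) ℤ) : Space A → StdSusp A :=
  basePoint (stdData A)

/-- The orbit equations of a continuous orbit equivalence. -/
def OrbitEqFns (A : Matrix (Fin N) (Fin N) ℤ) (B : Matrix (Fin M) (Fin M) ℤ)
    (h : Space A ≃ₜ Space B) (k1 l1 : C(Space A, ℕ)) (k2 l2 : C(Space B, ℕ)) : Prop :=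
  (∀ x : Space A, (shift B)^[k1 x] (h (shift A x)) = (shift B)^[l1 x] (h x)) ∧
  (∀ y : Space B, (shift A)^[k2 y] (h.symm (shift B y)) = (shift A)^[l2 y] (h.symm y))

/-- `(X_A, σ_A)` and `(X_B, σ_B)` are continuously orbit equivalent. -/
def ContOrbitEquiv (A : Matrix (Fin N) (Fin N) ℤ) (B : Matrix (Fin M) (Fin M) ℤ) : Prop :=
  ∃ h : Space A ≃ₜ Space B, ∃ k1 l1 : C(Space A, ℕ), ∃ k2 l2 : C(Space B, ℕ),
    OrbitEqFns A B h k1 l1 k2 l2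

/-- One-sided flow equivalence via the homeomorphism `h`. -/
def FlowEquivVia (A : Matrix (Fin N) (Fin N) ℤ) (B : Matrix (Fin M) (Fin M) ℤ)
    (h : Space A ≃ₜ Space B) : Prop :=
  ∃ T₁ : SuspData A, IsSuspTriplet T₁ ∧ ∃ T₂ : SuspData B, IsSuspTriplet T₂ ∧
  ∃ Φ₁ : Susp T₁ → StdSusp B, Continuous Φ₁ ∧
  ∃ Φ₂ : Susp T₂ → StdSusp A, Continuous Φ₂ ∧
  (∀ (t : ℝ≥0) (p : Susp T₁), Φ₁ (flow T₁ t p) = flow (stdData B) t (Φ₁ p)) ∧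
  (∀ x : Space A, Φ₁ (basePoint T₁ x) = stdBase B (h x)) ∧
  (∀ (t : ℝ≥0) (q : Susp T₂), Φ₂ (flow T₂ t q) = flow (stdData A) t (Φ₂ q)) ∧
  (∀ y : Space B, Φ₂ (basePoint T₂ y) = stdBase A (h.symm y))

/-- `(X_A, σ_A)` and `(X_B, σ_B)` are one-sided flow equivalent. -/
def OneSidedFlowEquiv (A : Matrix (Fin N) (Fin N) ℤ) (B : Matrix (Fin M) (Fin M) ℤ) : Prop :=
  ∃ h : Space A ≃ₜ Space B, FlowEquivVia A B h

/-- `f^m(x) = Σ_{i<m} f(σ_A^i(x))` for integer-valued `f`. -/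
def birk (A : Matrix (Fin N) (Fin N) ℤ) (f : Space A → ℤ) (m : ℕ) (x : Space A) : ℤ :=
  ∑ i ∈ Finset.range m, f ((shift A)^[i] x)

/-- `f^m(x) = Σ_{i<m} f(σ_A^i(x))` for real-valued `f`. -/
def birkR (A : Matrix (Fin N) (Fin N) ℤ) (f : Space A → ℝ) (m : ℕ) (x : Space A) : ℝ :=
  ∑ i ∈ Finset.range m, f ((shift A)^[i] x)

/-- `f^m(x) = Σ_{i<m} f(σ_A^i(x))` for ℕ-valued `f`. -/
def birkN (A : Matrix (Fin N) (Fin N) ℤ) (f : Space A → ℕ) (m : ℕ) (x : Space A) : ℕ :=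
  ∑ i ∈ Finset.range m, f ((shift A)^[i] x)

/-- The map `Ψ_h` associated with a continuous orbit equivalence. -/
def psi (A : Matrix (Fin N) (Fin N) ℤ) (B : Matrix (Fin M) (Fin M) ℤ)
    (h : Space A → Space B) (l1 k1 : Space A → ℕ) (f : Space B → ℤ) :
    Space A → ℤ :=
  fun x => (∑ i ∈ Finset.range (l1 x), f ((shift B)^[i] (h x)))
    - ∑ j ∈ Finset.range (k1 x), f ((shift B)^[j] (h (shift A x)))

/-- The dynamical zeta function `ζ_{A,f}(s)` with potential `f`. -/
noncomputable def zeta (A : Matrix (Fin N) (Fin N) ℤ) (f : Space A → ℤ) (s : ℂ) : ℂ :=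
  Complex.exp (∑' n : ℕ, (1 / (n + 1 : ℂ)) *
    ∑' x : {x : Space A // (shift A)^[n + 1] x = x},
      Complex.exp (-s * ((birk A f (n + 1) x.1 : ℤ) : ℂ)))

/-- `γ` is a periodic orbit of `(X_A, σ_A)`. -/
def IsPerOrbit (A : Matrix (Fin N) (Fin N) ℤ) (γ : Set (Space A)) : Prop :=
  ∃ (x : Space A) (p : ℕ), 0 < p ∧ (shift A)^[p] x = x ∧
    (∀ q : ℕ, 0 < q → (shift A)^[q] x = x → p ≤ q) ∧
    γ = {y | ∃ i : ℕ, i < p ∧ y = (shift A)^[i] x}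

/-- `τ` is a primitive periodic orbit of the flow on the one-sided suspension. -/
def IsFlowOrbit {A : Matrix (Fin N) (Fin N) ℤ} (T : SuspData A) (τ : Set (Susp T)) : Prop :=
  ∃ u : Susp T, (∃ t : ℝ≥0, 0 < t ∧ flow T t u = u) ∧
    τ = Set.range (fun t : ℝ≥0 => flow T t u)

/-- `ℓ(u) = min { t > 0 : φ_{A,t}(u) = u }`. -/
noncomputable def pointLen {A : Matrix (Fin N) (Fin N) ℤ} (T : SuspData A) (u : Susp T) : ℝ≥0 :=
  sInf {t : ℝ≥0 | 0 < t ∧ flow T t u = u}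

/-- `ℓ(τ) = min { t > 0 : φ_{A,t}(u) = u for all u ∈ τ }`. -/
noncomputable def orbitLen {A : Matrix (Fin N) (Fin N) ℤ} (T : SuspData A)
    (τ : Set (Susp T)) : ℝ≥0 :=
  sInf {t : ℝ≥0 | 0 < t ∧ ∀ u ∈ τ, flow T t u = u}

section Cylinders

variable {A : Matrix (Fin N) (Fin N) ℤ}

/-- Two points of the shift space have the same first `m` coordinates. -/
def Agree (m : ℕ) (x y : Space A) : Prop := ∀ t < m, x.1 t = y.1 t

lemma shift_iterate_apply (n : ℕ) (x : Space A) (t : ℕ) :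
    ((shift A)^[n] x).1 t = x.1 (t + n) := by
  induction n generalizing x with
  | zero => rfl
  | succ n ih =>
    rw [Function.iterate_succ_apply, ih]
    rfl

lemma Agree.symm {m : ℕ} {x y : Space A} (h : Agree m x y) : Agree m y x :=
  fun t ht => (h t ht).symm

lemma Agree.trans {m : ℕ} {x y z : Space A} (h : Agree m x y) (h' : Agree m y z) :
    Agree m x z :=
  fun t ht => (h t ht).trans (h' t ht)

lemma Agree.mono {m n : ℕ} (hmn : m ≤ n) {x y : Space A} (h : Agree n x y) : Agree m x y :=
  fun t ht => h t (ht.trans_le hmn)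

lemma Agree.shift_iterate {m n i : ℕ} {x y : Space A} (h : Agree n x y) (hi : m + i ≤ n) :
    Agree m ((shift A)^[i] x) ((shift A)^[i] y) := by
  intro t ht
  rw [shift_iterate_apply, shift_iterate_apply]
  exact h _ (by omega)

lemma isOpen_agree (m : ℕ) (x : Space A) : IsOpen {y | Agree m x y} := by
  have : {y | Agree m x y} = ⋂ t ∈ Set.Iio m, {y : Space A | y.1 t = x.1 t} := by
    ext y
    simp [Agree, eq_comm]
  rw [this]
  refine (Set.finite_Iio m).isOpen_biInter fun t _ => ?_
  have hcont : Continuous fun y : Space A => y.1 t :=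
    (continuous_apply t).comp continuous_subtype_val
  exact (isOpen_discrete {x.1 t}).preimage hcont

lemma exists_agree_subset {U : Set (Space A)} (hU : IsOpen U) {x : Space A} (hx : x ∈ U) :
    ∃ m, ∀ y, Agree m x y → y ∈ U := by
  obtain ⟨V, hV, rfl⟩ := isOpen_induced_iff.1 hU
  obtain ⟨I, u, hu, hsub⟩ := isOpen_pi_iff.1 hV x.1 hx
  refine ⟨I.sup id + 1, fun y hy => hsub fun i hi => ?_⟩
  rw [← hy i (Nat.lt_succ_of_le (Finset.le_sup (f := id) hi))]
  exact (hu i hi).2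

instance compactSpace_space (A : Matrix (Fin N) (Fin N) ℤ) : CompactSpace (Space A) := by
  apply isCompact_iff_compactSpace.1
  apply IsClosed.isCompact
  change IsClosed {x : ℕ → Fin N | ∀ n, A (x n) (x (n + 1)) = 1}
  rw [Set.ofPred_forall]
  refine isClosed_iInter fun n => ?_
  have hcont : Continuous fun x : ℕ → Fin N => (x n, x (n + 1)) :=
    (continuous_apply n).prodMk (continuous_apply (n + 1))
  exact (isClosed_discrete {p : Fin N × Fin N | A p.1 p.2 = 1}).preimage hcont

lemma exists_agree_imp_eq {β : Type*} [TopologicalSpace β] [DiscreteTopology β]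
    {f : Space A → β} (hf : Continuous f) : ∃ m, ∀ x y, Agree m x y → f x = f y := by
  have hloc : ∀ x, ∃ m, ∀ y, Agree m x y → f y = f x := fun x =>
    exists_agree_subset ((isOpen_discrete {f x}).preimage hf) rfl
  choose m hm using hloc
  obtain ⟨s, hs⟩ := isCompact_univ.elim_finite_subcover (fun x => {y | Agree (m x) x y})
    (fun x => isOpen_agree _ x) (fun x _ => Set.mem_iUnion.2 ⟨x, fun _ _ => rfl⟩)
  refine ⟨s.sup m, fun y z hyz => ?_⟩
  obtain ⟨x, hxs, hx⟩ := Set.mem_iUnion₂.1 (hs (Set.mem_univ y))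
  rw [hm x y hx, hm x z (Agree.trans hx (hyz.mono (Finset.le_sup hxs)))]

lemma continuous_of_agree {β : Type*} [TopologicalSpace β] {f : Space A → β} {m : ℕ}
    (h : ∀ x y, Agree m x y → f x = f y) : Continuous f := by
  refine IsLocallyConstant.continuous ((IsLocallyConstant.iff_exists_open f).2 fun x => ?_)
  exact ⟨_, isOpen_agree m x, fun _ _ => rfl, fun y hy => (h x y hy).symm⟩

/-- The point whose first `n` coordinates are those of `w`, followed by `x`. -/
def splice (w x : Space A) (n : ℕ) (h : w.1 n = x.1 0) : Space A :=
  ⟨fun t => if t < n then w.1 t else x.1 (t - n), fun t => by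
    rcases lt_trichotomy (t + 1) n with h1 | h1 | h1
    · simpa [h1, (by omega : t < n)] using w.2 t
    · subst h1
      simpa [← h] using w.2 t
    · have h2 : ¬ t < n := by omega
      have h3 : ¬ t + 1 < n := by omega
      have h4 : t + 1 - n = t - n + 1 := by omega
      simpa only [h2, h3, h4, if_false] using x.2 (t - n)⟩

lemma shift_iterate_splice (w x : Space A) (n : ℕ) (h : w.1 n = x.1 0) :
    (shift A)^[n] (splice w x n h) = x := by
  ext t
  rw [shift_iterate_apply]
  simp [splice]

lemma agree_splice {w x : Space A} {n m : ℕ} (h : w.1 n = x.1 0)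
    (hx : Agree m ((shift A)^[n] w) x) : Agree (n + m) w (splice w x n h) := by
  intro t ht
  by_cases htn : t < n
  · simp [splice, htn]
  · have := hx (t - n) (by omega)
    rw [shift_iterate_apply, Nat.sub_add_cancel (by omega)] at this
    simp [splice, htn, this]

/-- The point obtained from `x` by inserting the symbol `i` in front. -/
def prepend (i : Fin N) (x : Space A) (h : A i (x.1 0) = 1) : Space A :=
  ⟨fun t => Nat.casesOn t i x.1, fun t => by
    cases t with
    | zero => exact h
    | succ t => exact x.2 t⟩

lemma shift_prepend (i : Fin N) (x : Space A) (h : A i (x.1 0) = 1) :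
    shift A (prepend i x h) = x := rfl

/-- The periodic point repeating the block of length `d` of `w` that starts at position `i`. -/
def periodize (w : Space A) (i d : ℕ) (hd : 0 < d) (h : w.1 i = w.1 (i + d)) : Space A :=
  ⟨fun t => w.1 (i + t % d), fun t => by
    have hlt := Nat.mod_lt t hd
    change A (w.1 (i + t % d)) (w.1 (i + (t + 1) % d)) = 1
    by_cases h1 : t % d + 1 < d
    · rw [Nat.add_mod_eq_add_mod_right 1 (Nat.mod_mod t d).symm, Nat.mod_eq_of_lt h1]
      exact w.2 (i + t % d)
    · have h2 : t % d + 1 = d := by omega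
      rw [Nat.add_mod_eq_add_mod_right 1 (Nat.mod_mod t d).symm, h2, Nat.mod_self, add_zero, h]
      have := w.2 (i + t % d)
      rwa [add_assoc, h2] at this⟩

lemma shift_iterate_periodize (w : Space A) (i d : ℕ) (hd : 0 < d) (h : w.1 i = w.1 (i + d)) :
    (shift A)^[d] (periodize w i d hd h) = periodize w i d hd h := by
  ext t
  rw [shift_iterate_apply]
  simp [periodize]

lemma agree_periodize {w : Space A} {i d m : ℕ} (hd : 0 < d) (h : w.1 i = w.1 (i + d))
    (hw : Agree m ((shift A)^[i] w) ((shift A)^[i + d] w)) :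
    Agree (d + m) ((shift A)^[i] w) (periodize w i d hd h) := by
  intro t
  induction t using Nat.strong_induction_on with
  | _ t ih =>
    intro ht
    by_cases htd : t < d
    · rw [shift_iterate_apply]
      simp [periodize, Nat.mod_eq_of_lt htd, add_comm]
    · have h1 := ih (t - d) (by omega) (by omega)
      have h2 := hw (t - d) (by omega)
      rw [h1] at h2
      rw [shift_iterate_apply] at h2 ⊢
      rw [(by omega : t + i = t - d + (i + d)), ← h2]
      simp only [periodize]
      rw [← Nat.mod_eq_sub_mod (by omega)]

end Cylinders

section Irreducible

variable {A : Matrix (Fin N) (Fin N) ℤ}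

lemma IsIrreducible.exists_succ (hA : IsZeroOne A) (hirr : IsIrreducible A) (i : Fin N) :
    ∃ j, A i j = 1 := by
  obtain ⟨m, hm, h⟩ := hirr i i
  by_contra! hne
  have hz : ∀ j, A i j = 0 := fun j => (hA i j).resolve_right (hne j)
  obtain ⟨m, rfl⟩ := Nat.exists_eq_succ_of_ne_zero hm.ne'
  rw [pow_succ', Matrix.mul_apply] at h
  exact h (Finset.sum_eq_zero fun j _ => by rw [hz, zero_mul])

lemma IsIrreducible.exists_pred (hA : IsZeroOne A) (hirr : IsIrreducible A) (j : Fin N) :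
    ∃ i, A i j = 1 := by
  obtain ⟨m, hm, h⟩ := hirr j j
  by_contra! hne
  have hz : ∀ i, A i j = 0 := fun i => (hA i j).resolve_right (hne i)
  obtain ⟨m, rfl⟩ := Nat.exists_eq_succ_of_ne_zero hm.ne'
  rw [pow_succ, Matrix.mul_apply] at h
  exact h (Finset.sum_eq_zero fun j _ => by rw [hz, mul_zero])

lemma exists_point_from (hA : IsZeroOne A) (hirr : IsIrreducible A) (i : Fin N) :
    ∃ x : Space A, x.1 0 = i := by
  choose s hs using hirr.exists_succ hA
  refine ⟨⟨fun n => s^[n] i, fun n => ?_⟩, rfl⟩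
  change A (s^[n] i) (s^[n + 1] i) = 1
  rw [Function.iterate_succ_apply']
  exact hs _

lemma exists_two_succ (hA : IsZeroOne A) (hirr : IsIrreducible A)
    (hnp : ¬ IsPermutationMatrix A) : ∃ i j j', j ≠ j' ∧ A i j = 1 ∧ A i j' = 1 := by
  by_contra! hcon
  choose s hs using hirr.exists_succ hA
  have huniq : ∀ i j, A i j = 1 → s i = j := fun i j h => by
    by_contra hne
    exact hcon i _ _ hne (hs i) h
  have hsurj : Function.Surjective s := fun j => by
    obtain ⟨i, hi⟩ := hirr.exists_pred hA j
    exact ⟨i, huniq i j hi⟩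
  refine hnp ⟨Equiv.ofBijective s (Finite.surjective_iff_bijective.1 hsurj), fun i j => ?_⟩
  simp only [Equiv.ofBijective_apply]
  split_ifs with h
  · rw [← h, hs]
  · exact (hA i j).resolve_right fun h' => h (huniq i j h')

lemma IsIrreducible.induction (hA : IsZeroOne A) (hirr : IsIrreducible A) {P : Fin N → Prop}
    (hP : ∀ i j, A i j = 1 → P i → P j) {i : Fin N} (hi : P i) (j : Fin N) : P j := by
  obtain ⟨m, -, h⟩ := hirr i j
  induction m generalizing j with
  | zero =>
    by_cases hij : i = j
    · exact hij ▸ hi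
    · simp [hij] at h
  | succ m ih =>
    rw [pow_succ, Matrix.mul_apply] at h
    obtain ⟨k, -, hk⟩ := Finset.exists_ne_zero_of_sum_ne_zero h
    exact hP k j ((hA k j).resolve_left (right_ne_zero_of_mul hk))
      (ih k (left_ne_zero_of_mul hk))

/-- The shift space has no isolated points. -/
lemma exists_agree_ne (hA : IsZeroOne A) (hirr : IsIrreducible A)
    (hnp : ¬ IsPermutationMatrix A) (x : Space A) (m : ℕ) : ∃ z, Agree m x z ∧ z ≠ x := by
  by_contra! hcon
  have h0 : ∀ z z' : Space A, z.1 0 = x.1 m → z'.1 0 = x.1 m → z = z' := by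
    have key : ∀ z : Space A, z.1 0 = x.1 m → z = (shift A)^[m] x := fun z hz => by
      have hag : Agree m x (splice x z m hz.symm) := by
        simpa using agree_splice (m := 0) hz.symm (fun t ht => absurd ht (Nat.not_lt_zero t))
      rw [← hcon _ hag, shift_iterate_splice]
    intro z z' hz hz'
    rw [key z hz, key z' hz']
  have hall := hirr.induction hA (P := fun i => ∀ z z' : Space A, z.1 0 = i → z'.1 0 = i → z = z')
    (by
      intro i j hij hi z z' hz hz'
      have := hi (prepend i z (by rw [hz, hij])) (prepend i z' (by rw [hz', hij])) rfl rfl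
      simpa only [shift_prepend] using congrArg (shift A) this) h0
  obtain ⟨i, j, j', hne, hj, hj'⟩ := exists_two_succ hA hirr hnp
  obtain ⟨z, rfl⟩ := exists_point_from hA hirr j
  obtain ⟨z', rfl⟩ := exists_point_from hA hirr j'
  have := congrArg (shift A) (hall i (prepend i z hj) (prepend i z' hj') rfl rfl)
  simp only [shift_prepend] at this
  exact hne (by rw [this])

end Irreducible

section Cohomology

variable {A : Matrix (Fin N) (Fin N) ℤ}

lemma birk_add (f : Space A → ℤ) (a b : ℕ) (x : Space A) :
    birk A f (a + b) x = birk A f a x + birk A f b ((shift A)^[a] x) := by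
  simp only [birk, Finset.sum_range_add, ← Function.iterate_add_apply]
  congr 1
  exact Finset.sum_congr rfl fun i _ => by rw [add_comm]

lemma birk_congr {f : Space A → ℤ} {m : ℕ} (hf : ∀ x y, Agree m x y → f x = f y) {n : ℕ}
    {x y : Space A} (h : Agree (n + m) x y) : birk A f n x = birk A f n y :=
  Finset.sum_congr rfl fun i hi =>
    hf _ _ (h.shift_iterate (by have := Finset.mem_range.1 hi; omega))

lemma exists_agree_shift_iterate (m : ℕ) (w : Space A) :
    ∃ i d, 0 < d ∧ i + d ≤ N ^ m ∧ Agree m ((shift A)^[i] w) ((shift A)^[i + d] w) := by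
  let F : Fin (N ^ m + 1) → (Fin m → Fin N) := fun i t => w.1 (t + i)
  obtain ⟨i, j, hij, hF⟩ := Fintype.exists_ne_map_eq_of_card_lt F (by simp)
  have hag : ∀ t < m, w.1 (t + i) = w.1 (t + j) := fun t ht => congrFun hF ⟨t, ht⟩
  have hne : (i : ℕ) ≠ j := fun h => hij (Fin.ext h)
  rcases lt_or_gt_of_ne hne with h | h
  · refine ⟨i, j - i, by omega, by omega, fun t ht => ?_⟩
    rw [shift_iterate_apply, shift_iterate_apply, Nat.add_sub_cancel' h.le, hag t ht]
  · refine ⟨j, i - j, by omega, by omega, fun t ht => ?_⟩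
    rw [shift_iterate_apply, shift_iterate_apply, Nat.add_sub_cancel' h.le, hag t ht]

/-- Birkhoff sums are bounded below as soon as they are nonnegative along short periodic orbits. -/
lemma birk_lower_bound {f : Space A → ℤ} {m : ℕ} (hm : 0 < m)
    (hf : ∀ x y, Agree m x y → f x = f y)
    (hper : ∀ p, 0 < p → p ≤ N ^ m → ∀ x, (shift A)^[p] x = x → 0 ≤ birk A f p x)
    {D : ℤ} (hD0 : 0 ≤ D) (hD : ∀ x, -D ≤ f x) (n : ℕ) (w : Space A) :
    -(N ^ m * D) ≤ birk A f n w := by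
  induction n using Nat.strong_induction_on generalizing w with
  | _ n ih =>
    by_cases hn : n < N ^ m
    · have h1 : ∑ _i ∈ Finset.range n, (-D) ≤ birk A f n w :=
        Finset.sum_le_sum fun i _ => hD _
      have h2 : (n : ℤ) ≤ (N : ℤ) ^ m := by exact_mod_cast hn.le
      simp only [Finset.sum_const, Finset.card_range, nsmul_eq_mul] at h1
      nlinarith
    · obtain ⟨i, d, hd, hid, hag⟩ := exists_agree_shift_iterate m w
      have hw : w.1 i = w.1 (i + d) := by
        have := hag 0 hm
        simpa [shift_iterate_apply] using this
      have hw' : w.1 i = ((shift A)^[i + d] w).1 0 := by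
        rw [hw, shift_iterate_apply, zero_add]
      obtain ⟨e, rfl⟩ := Nat.exists_eq_add_of_le (hid.trans (not_lt.1 hn))
      have hs := ih (i + e) (by omega) (splice w _ i hw')
      have hp := hper d hd (by omega) _ (shift_iterate_periodize w i d hd hw)
      rw [birk_add, shift_iterate_splice, ← birk_congr hf (agree_splice hw' hag)] at hs
      rw [← birk_congr hf (agree_periodize hd hw hag)] at hp
      rw [birk_add, birk_add]
      linarith

lemma exists_bound (f : C(Space A, ℤ)) : ∃ D : ℕ, ∀ x, |f x| ≤ D := by
  obtain ⟨D, hD⟩ := (isCompact_range (f.continuous.abs)).bddAbove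
  exact ⟨D.toNat, fun x => (hD ⟨x, rfl⟩).trans (Int.self_le_toNat D)⟩

/-- A function with nonnegative sums along short periodic orbits is cohomologous to a nonnegative
function. -/
lemma exists_transfer {f : C(Space A, ℤ)} {m : ℕ} (hm : 0 < m)
    (hf : ∀ x y, Agree m x y → f x = f y)
    (hper : ∀ p, 0 < p → p ≤ N ^ m → ∀ x, (shift A)^[p] x = x → 0 ≤ birk A f p x) :
    ∃ g : C(Space A, ℤ), ∀ x, 0 ≤ f x + (g x - g (shift A x)) := by
  obtain ⟨D, hD⟩ := exists_bound f
  let S : Space A → Set ℤ := fun x => {s | ∃ n w, (shift A)^[n] w = x ∧ s = birk A f n w}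
  have hbdd : ∀ x, BddBelow (S x) := fun x => by
    refine ⟨-(N ^ m * D), ?_⟩
    rintro _ ⟨n, w, -, rfl⟩
    exact birk_lower_bound hm hf hper (Int.natCast_nonneg D) (fun x => (abs_le.1 (hD x)).1) n w
  have hne : ∀ x, (S x).Nonempty := fun x => ⟨_, 0, x, rfl, rfl⟩
  have hsub : ∀ x y, Agree m x y → S x ⊆ S y := by
    rintro x y hxy _ ⟨n, w, rfl, rfl⟩
    have hw : w.1 n = y.1 0 := by
      rw [← hxy 0 hm, shift_iterate_apply, zero_add]
    exact ⟨n, splice w y n hw, shift_iterate_splice .., birk_congr hf (agree_splice hw hxy)⟩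
  refine ⟨⟨fun x => sInf (S x), continuous_of_agree (m := m) fun x y h => ?_⟩, fun x => ?_⟩
  · rw [(hsub x y h).antisymm (hsub y x h.symm)]
  · obtain ⟨n, w, hw, hs⟩ := Int.csInf_mem (hne x) (hbdd x)
    have : sInf (S (shift A x)) ≤ sInf (S x) + f x := by
      refine csInf_le (hbdd _) ⟨n + 1, w, ?_, ?_⟩
      · rw [Function.iterate_succ_apply', hw]
      · rw [birk_add, hw, ← hs]
        simp [birk]
    simp only [ContinuousMap.coe_mk]
    linarith

lemma cohClass_mem_cohPos {f : C(Space A, ℤ)} (g : C(Space A, ℤ))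
    (h : ∀ x, 0 ≤ f x + (g x - g (shift A x))) : cohClass A f ∈ CohPos A := by
  refine ⟨f + (g - g.comp (shiftMap A)), h, ?_⟩
  refine QuotientAddGroup.eq.2 ?_
  rw [neg_add_cancel_left]
  exact AddSubgroup.subset_closure ⟨g, rfl⟩

/-- A function with positive sums along all periodic orbits represents an order unit. -/
lemma isOrderUnit_of_birk_pos (hN : 0 < N) {c : C(Space A, ℤ)}
    (hper : ∀ p, 0 < p → ∀ x, (shift A)^[p] x = x → 0 < birk A c p x) :
    IsOrderUnit A (cohClass A c) := by
  obtain ⟨m, hm⟩ := exists_agree_imp_eq c.continuous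
  have hc : ∀ x y, Agree (m + 1) x y → c x = c y := fun x y h => hm x y (h.mono m.le_succ)
  obtain ⟨g, hg⟩ := exists_transfer m.succ_pos hc fun p hp _ x hx => (hper p hp x hx).le
  refine ⟨cohClass_mem_cohPos g hg, fun v => ?_⟩
  obtain ⟨v, rfl⟩ := QuotientAddGroup.mk_surjective v
  obtain ⟨u, hu⟩ := exists_transfer (f := (N ^ (m + 1)) • c - 1) m.succ_pos
    (fun x y h => by simp [hc x y h]) fun p hp hpV x hx => by
      have h1 := hper p hp x hx
      have h2 : birk A ((N ^ (m + 1)) • c - 1 : C(Space A, ℤ)) p x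
          = (N : ℤ) ^ (m + 1) * birk A c p x - p := by
        simp [birk, Finset.mul_sum]
      have h3 : (p : ℤ) ≤ (N : ℤ) ^ (m + 1) := by exact_mod_cast hpV
      rw [h2]
      exact sub_nonneg.2 (h3.trans (le_mul_of_one_le_right (by positivity) h1))
  obtain ⟨D, hD⟩ := exists_bound v
  refine ⟨(D + 1) * N ^ (m + 1), by positivity, ?_⟩
  refine cohClass_mem_cohPos (f := ((D + 1) * N ^ (m + 1)) • c - v) ((D + 1) • u) fun x => ?_
  have h1 := hu x
  have h2 := (abs_le.1 (hD x)).2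
  have h3 : ((N ^ (m + 1)) • c - 1 : C(Space A, ℤ)) x = (N : ℤ) ^ (m + 1) * c x - 1 := by
    simp
  have h4 : (((D + 1) * N ^ (m + 1)) • c - v : C(Space A, ℤ)) x
      = (D + 1) * ((N : ℤ) ^ (m + 1) * c x) - v x := by
    simp [mul_assoc]
  have h5 : ∀ y, ((D + 1) • u : C(Space A, ℤ)) y = (D + 1) * u y := fun y => by simp
  rw [h3] at h1
  rw [h4, h5, h5]
  nlinarith

end Cohomology

section OrbitEquivalence

variable {A : Matrix (Fin N) (Fin N) ℤ} {B : Matrix (Fin M) (Fin M) ℤ}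

lemma continuous_birkN (f : C(Space A, ℕ)) (p : ℕ) : Continuous (birkN A f p) :=
  continuous_finsetSum _ fun i _ => f.continuous.comp ((continuous_shift A).iterate i)

lemma orbit_eq_iterate {h : Space A → Space B} {k l : Space A → ℕ}
    (hkl : ∀ x, (shift B)^[k x] (h (shift A x)) = (shift B)^[l x] (h x)) (p : ℕ) (x : Space A) :
    (shift B)^[birkN A k p x] (h ((shift A)^[p] x)) = (shift B)^[birkN A l p x] (h x) := by
  induction p with
  | zero => rfl
  | succ p ih =>
    simp only [birkN, Finset.sum_range_succ] at ih ⊢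
    rw [Function.iterate_add_apply, Function.iterate_succ_apply', hkl,
      ← Function.iterate_add_apply, add_comm, Function.iterate_add_apply, ih,
      ← Function.iterate_add_apply, add_comm]

/-- Prepending longer and longer pieces of the periodic point `x` contracts towards `x`; its
conjugate by `h` must contract towards `h x`, which forces positivity of the cocycle. -/
lemma birk_cocycle_pos (hA : IsZeroOne A) (hirr : IsIrreducible A)
    (hnp : ¬ IsPermutationMatrix A) {h : Space A → Space B} (hcont : Continuous h)
    (hinj : Function.Injective h) {k l : C(Space A, ℕ)}
    (hkl : ∀ x, (shift B)^[k x] (h (shift A x)) = (shift B)^[l x] (h x))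
    {p : ℕ} (hp : 0 < p) {x : Space A} (hx : (shift A)^[p] x = x) :
    birkN A k p x < birkN A l p x := by
  by_contra! hle
  obtain ⟨s, hs⟩ := Nat.exists_eq_add_of_le hle
  set K := birkN A k p x with hK
  set L := birkN A l p x with hL
  have hcoord : ∀ R : ℕ, ∃ m, ∀ x y, Agree m x y → Agree R (h x) (h y) := fun R => by
    have hcR : Continuous fun x => fun t : Fin R => (h x).1 t :=
      continuous_pi fun t => (continuous_apply _).comp (continuous_subtype_val.comp hcont)
    obtain ⟨m, hm⟩ := exists_agree_imp_eq hcR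
    exact ⟨m, fun x y hxy t ht => congrFun (hm x y hxy) ⟨t, ht⟩⟩
  obtain ⟨m₁, hm₁⟩ := exists_agree_imp_eq (continuous_birkN k p)
  obtain ⟨m₂, hm₂⟩ := exists_agree_imp_eq (continuous_birkN l p)
  obtain ⟨m₃, hm₃⟩ := hcoord K
  obtain ⟨z, hz, hzx⟩ := exists_agree_ne hA hirr hnp x (m₁ + m₂ + m₃ + 1)
  have hxn : ∀ n, (shift A)^[n * p] x = x := fun n => by
    rw [mul_comm, Function.iterate_mul]
    exact Function.iterate_fixed hx n
  have hstart : ∀ n, x.1 (n * p) = z.1 0 := fun n => by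
    rw [← hz 0 (by omega)]
    conv_rhs => rw [← hxn n, shift_iterate_apply, zero_add]
  let w : ℕ → Space A := fun n => splice x z (n * p) (hstart n)
  have hwag : ∀ n, Agree (n * p + (m₁ + m₂ + m₃ + 1)) x (w n) := fun n =>
    agree_splice (hstart n) (by rw [hxn]; exact hz)
  have hwshift : ∀ n, (shift A)^[p] (w (n + 1)) = w n := fun n => by
    ext t
    rw [shift_iterate_apply]
    have hxt : x.1 (t + p) = x.1 t := by
      conv_rhs => rw [← hx, shift_iterate_apply]
    have h1 : (n + 1) * p = n * p + p := by ring
    simp only [w, splice, h1, Nat.add_lt_add_iff_right, Nat.add_sub_add_right, hxt]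
  have hw0 : w 0 = z := by
    ext t
    simp [w, splice]
  have hrel : ∀ n i, (h (w n)).1 (i + K) = (h (w (n + 1))).1 (i + L) := fun n i => by
    have h1 := orbit_eq_iterate hkl p (w (n + 1))
    rw [hwshift, ← hm₁ x _ ((hwag (n + 1)).mono (by omega)),
      ← hm₂ x _ ((hwag (n + 1)).mono (by omega)), ← hK, ← hL] at h1
    rw [← shift_iterate_apply, ← shift_iterate_apply, h1]
  have hrelx : ∀ i, (h x).1 (i + K) = (h x).1 (i + L) := fun i => by
    have h1 := orbit_eq_iterate hkl p x
    rw [hx, ← hK, ← hL] at h1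
    rw [← shift_iterate_apply, ← shift_iterate_apply, h1]
  have hinit : ∀ n i, i < K → (h (w n)).1 i = (h x).1 i := fun n i hi =>
    (hm₃ x (w n) ((hwag n).mono (by omega)) i hi).symm
  suffices hfin : h (w 0) = h x from hzx (hw0 ▸ hinj hfin)
  rcases Nat.eq_zero_or_pos s with rfl | hs0
  · have hconst : ∀ n, h (w n) = h (w 0) := fun n => by
      induction n with
      | zero => rfl
      | succ n ih =>
        rw [← ih]
        ext i
        by_cases hi : i < K
        · rw [hinit _ _ hi, hinit _ _ hi]
        · have := hrel n (i - K)
          rw [Nat.sub_add_cancel (by omega), (by omega : i - K + L = i)] at this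
          rw [this]
    ext i
    obtain ⟨m, hm⟩ := hcoord (i + 1)
    have hag : Agree m x (w m) := (hwag m).mono (by nlinarith)
    rw [← hconst m, hm x (w m) hag i i.lt_succ_self]
  · have hall : ∀ i n, (h (w n)).1 i = (h x).1 i := fun i => by
      induction i using Nat.strong_induction_on with
      | _ i ih =>
        intro n
        by_cases hi : i < K
        · exact hinit n i hi
        · have h1 := hrel n (i - K)
          have h2 := hrelx (i - K)
          rw [Nat.sub_add_cancel (by omega)] at h1 h2
          rw [h1, h2, ih _ (by omega)]
    ext i
    rw [hall]

/-- A continuous natural-number-valued function, regarded as a real-valued one. -/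
def natToReal (f : C(Space A, ℕ)) : C(Space A, ℝ) :=
  ⟨fun x => (f x : ℝ), continuous_of_discreteTopology.comp f.continuous⟩

/-- The suspension data `(l, k, 0)` given by the cocycle functions of an orbit map. -/
def orbitData (k l : C(Space A, ℕ)) : SuspData A := ⟨natToReal l, natToReal k, 0⟩

lemma isSuspTriplet_orbitData (hN : 0 < N) (hA : IsZeroOne A) (hirr : IsIrreducible A)
    (hnp : ¬ IsPermutationMatrix A) {h : Space A → Space B} (hcont : Continuous h)
    (hinj : Function.Injective h) {k l : C(Space A, ℕ)}
    (hkl : ∀ x, (shift B)^[k x] (h (shift A x)) = (shift B)^[l x] (h x)) :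
    IsSuspTriplet (orbitData k l) := by
  refine ⟨fun x => Nat.cast_nonneg _, fun x => Nat.cast_nonneg _, ?_,
    fun x => ⟨l x, sub_zero _⟩, fun x => ⟨k x, sub_zero _⟩⟩
  refine ⟨⟨fun x => (l x : ℤ) - k x, ?_⟩, fun x => ?_, ?_⟩
  · exact (continuous_of_discreteTopology.comp l.continuous).sub
      (continuous_of_discreteTopology.comp k.continuous)
  · simp [cFun, orbitData, natToReal]
  · refine isOrderUnit_of_birk_pos hN fun p hp x hx => ?_
    have := birk_cocycle_pos hA hirr hnp hcont hinj hkl hp hx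
    simp only [birk, ContinuousMap.coe_mk, Finset.sum_sub_distrib, sub_pos]
    exact_mod_cast this

lemma mkSusp_stdData_iterate (n : ℕ) (y : Space B) (r : ℝ) (hr : 0 ≤ r) :
    mkSusp (stdData B) ⟨(y, r + n), by simp only [stdData, ContinuousMap.zero_apply]; positivity⟩
      = mkSusp (stdData B) ⟨((shift B)^[n] y, r), hr⟩ := by
  induction n generalizing y with
  | zero => simp
  | succ n ih =>
    rw [Function.iterate_succ_apply, ← ih]
    refine Quotient.sound (Relation.EqvGen.rel _ _ ⟨?_, ?_⟩)
    · simp only [stdData, ContinuousMap.one_apply]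
      push_cast
      linarith [(Nat.cast_nonneg n : (0 : ℝ) ≤ n)]
    · simp only [cFun, stdData, ContinuousMap.one_apply, ContinuousMap.zero_apply]
      push_cast
      congr 1
      ring

/-- The map `(x, r) ↦ (h x, r)` on the spaces above the base. -/
def baseMap (k l : C(Space A, ℕ)) (h : Space A → Space B)
    (p : BaseSpace (orbitData k l)) : BaseSpace (stdData B) :=
  ⟨(h p.1.1, p.1.2), p.2⟩

lemma mkSusp_baseMap_eq {k l : C(Space A, ℕ)} {h : Space A → Space B}
    (hkl : ∀ x, (shift B)^[k x] (h (shift A x)) = (shift B)^[l x] (h x))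
    (p q : BaseSpace (orbitData k l)) (hpq : SuspRel (orbitData k l) p q) :
    mkSusp (stdData B) (baseMap k l h p) = mkSusp (stdData B) (baseMap k l h q) := by
  obtain ⟨⟨x, r⟩, hp⟩ := p
  obtain ⟨⟨y, r'⟩, hq⟩ := q
  obtain ⟨hr, he⟩ := hpq
  simp only [Prod.mk.injEq] at he
  obtain ⟨rfl, rfl⟩ := he
  have hr0 : 0 ≤ r - l x := sub_nonneg.2 hr
  have h1 := mkSusp_stdData_iterate (l x) (h x) (r - l x) hr0
  have h2 := mkSusp_stdData_iterate (k x) (h (shift A x)) (r - l x) hr0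
  simp only [hkl] at h2
  rw [← h1] at h2
  convert h2.symm using 3
  · simp [baseMap]
  · simp only [baseMap, cFun, orbitData, natToReal, ContinuousMap.coe_mk]
    congr 2
    ring

/-- The map of suspensions `[x, r] ↦ [h x, r]`. -/
def suspMap {k l : C(Space A, ℕ)} {h : Space A → Space B}
    (hkl : ∀ x, (shift B)^[k x] (h (shift A x)) = (shift B)^[l x] (h x)) :
    Susp (orbitData k l) → StdSusp B :=
  Quotient.lift (fun p => mkSusp (stdData B) (baseMap k l h p)) fun p q hpq => by
    induction hpq with
    | rel p q h => exact mkSusp_baseMap_eq hkl p q h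
    | refl p => rfl
    | symm p q _ ih => exact ih.symm
    | trans p q r _ _ ih₁ ih₂ => exact ih₁.trans ih₂

lemma continuous_suspMap {k l : C(Space A, ℕ)} {h : Space A → Space B} (hcont : Continuous h)
    (hkl : ∀ x, (shift B)^[k x] (h (shift A x)) = (shift B)^[l x] (h x)) :
    Continuous (suspMap hkl) := by
  refine Continuous.quotient_lift (continuous_quotient_mk'.comp ?_) _
  refine Continuous.subtype_mk ?_ _
  exact (hcont.comp (continuous_fst.comp continuous_subtype_val)).prodMk
    (continuous_snd.comp continuous_subtype_val)

lemma suspMap_flow {k l : C(Space A, ℕ)} {h : Space A → Space B}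
    (hkl : ∀ x, (shift B)^[k x] (h (shift A x)) = (shift B)^[l x] (h x)) (t : ℝ≥0)
    (p : Susp (orbitData k l)) :
    suspMap hkl (flow _ t p) = flow (stdData B) t (suspMap hkl p) := by
  induction p using Quotient.inductionOn
  rfl

end OrbitEquivalence

theorem contOrbitEquiv_implies_oneSidedFlowEquiv
    {N M : ℕ} (A : Matrix (Fin N) (Fin N) ℤ) (B : Matrix (Fin M) (Fin M) ℤ)
    (hN : 1 < N) (hM : 1 < M) (hA01 : IsZeroOne A) (hB01 : IsZeroOne B)
    (hAirr : IsIrreducible A) (hBirr : IsIrreducible B)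
    (hAnp : ¬ IsPermutationMatrix A) (hBnp : ¬ IsPermutationMatrix B)
    (hcoe : ContOrbitEquiv A B) :
    OneSidedFlowEquiv A B := by
  obtain ⟨h, k₁, l₁, k₂, l₂, h₁, h₂⟩ := hcoe
  exact ⟨h,
    orbitData k₁ l₁, isSuspTriplet_orbitData (zero_lt_one.trans hN) hA01 hAirr hAnp h.continuous
      h.injective h₁,
    orbitData k₂ l₂, isSuspTriplet_orbitData (zero_lt_one.trans hM) hB01 hBirr hBnp
      h.symm.continuous h.symm.injective h₂,
    suspMap h₁, continuous_suspMap h.continuous h₁,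
    suspMap h₂, continuous_suspMap h.symm.continuous h₂,
    suspMap_flow h₁, fun _ => rfl, suspMap_flow h₂, fun _ => rfl⟩

end OneSidedMarkov
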